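/- arXiv:0902.4730 — 7 statements merged into one kernel-verified Lean document; each statement's English description precedes it below -/
import Mathlib

section
/- Let P be a partially ordered set in which the relation > is well-founded, and define, for antichains A, B ⊆ P, the meet A ∧ B = (A↓ ∩ B↓)↑. Then for all antichains A, B, C of P, A ∧ (B ∧ C) = (A↓ ∩ B↓ ∩ C↓)↑; in particular the meet operation is associative. -/
/-- `upSet A` is the set of maximal elements of `A`: those `a ∈ A` such that
no `a' ∈ A` satisfies `a < a'`. -/
def upSet {P : Type*} [PartialOrder P] (A : Set P) : Set P :=
  {a | a ∈ A ∧ ∀ b ∈ A, ¬ a < b}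

/-- `downSet A` is the down-closure `{p | ∃ a ∈ A, p ≤ a}` of `A`. -/
def downSet {P : Type*} [PartialOrder P] (A : Set P) : Set P :=
  {p | ∃ a ∈ A, p ≤ a}

/-- The meet `A ∧ B = (A↓ ∩ B↓)↑`. -/
def meetA {P : Type*} [PartialOrder P] (A B : Set P) : Set P :=
  upSet (downSet A ∩ downSet B)

theorem downSet_meetA {P : Type*} [PartialOrder P]
    (hwf : WellFounded ((· > ·) : P → P → Prop)) (B C : Set P) :
    downSet (meetA B C) = downSet B ∩ downSet C := by
  ext p
  constructor
  · rintro ⟨a, ⟨⟨⟨b, hb, hab⟩, ⟨c, hc, hac⟩⟩, -⟩, hpa⟩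
    exact ⟨⟨b, hb, hpa.trans hab⟩, ⟨c, hc, hpa.trans hac⟩⟩
  · intro hp
    obtain ⟨m, ⟨hm, hpm⟩, hmax⟩ := hwf.has_min
      {q | q ∈ downSet B ∩ downSet C ∧ p ≤ q} ⟨p, hp, le_refl p⟩
    exact ⟨m, ⟨hm, fun b hb hlt => hmax b ⟨hb, hpm.trans hlt.le⟩ hlt⟩, hpm⟩

/-- If `>` is well-founded on the partially ordered set `P`, then for all
antichains `A, B, C ⊆ P`, `A ∧ (B ∧ C) = (A↓ ∩ B↓ ∩ C↓)↑`; in particular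
the meet is associative. -/
theorem stmt_4 {P : Type*} [PartialOrder P]
    (hwf : WellFounded ((· > ·) : P → P → Prop)) (A B C : Set P)
    (hA : IsAntichain (· ≤ ·) A) (hB : IsAntichain (· ≤ ·) B)
    (hC : IsAntichain (· ≤ ·) C) :
    meetA A (meetA B C) = upSet (downSet A ∩ downSet B ∩ downSet C) ∧
      meetA A (meetA B C) = meetA (meetA A B) C := by
  have h1 : meetA A (meetA B C) = upSet (downSet A ∩ downSet B ∩ downSet C) := by
    rw [meetA, downSet_meetA hwf, Set.inter_assoc]
  refine ⟨h1, h1.trans ?_⟩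
  rw [meetA, downSet_meetA hwf]
end

section
/- Let P be a partially ordered set in which the relation > is well-founded. Then for all antichains A, B of P, the absorption law A ∨ (A ∧ B) = A holds, where A ∨ B = (A ∪ B)↑ and A ∧ B = (A↓ ∩ B↓)↑. -/
/-- The join `A ∨ B = (A ∪ B)↑`. -/
def joinA {P : Type*} [PartialOrder P] (A B : Set P) : Set P :=
  upSet (A ∪ B)

/-- If `>` is well-founded on the partially ordered set `P`, then for all
antichains `A, B ⊆ P`, the absorption law `A ∨ (A ∧ B) = A` holds. -/
theorem stmt_5 {P : Type*} [PartialOrder P]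
    (hwf : WellFounded ((· > ·) : P → P → Prop)) (A B : Set P)
    (hA : IsAntichain (· ≤ ·) A) (hB : IsAntichain (· ≤ ·) B) :
    joinA A (meetA A B) = A := by
  ext x
  constructor
  · rintro ⟨hx | hx, hmax⟩
    · exact hx
    · obtain ⟨⟨⟨a, ha, hxa⟩, _⟩, _⟩ := hx
      rcases hxa.eq_or_lt with h | h
      · exact h ▸ ha
      · exact absurd h (hmax a (Or.inl ha))
  · intro hx
    refine ⟨Or.inl hx, ?_⟩
    rintro b (hb | hb) hlt
    · exact hA hx hb hlt.ne hlt.le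
    · obtain ⟨⟨⟨a, ha, hba⟩, _⟩, _⟩ := hb
      have h := hlt.trans_le hba
      exact hA hx ha h.ne h.le
end

section
/- Let P be a partially ordered set in which the relation > is well-founded. Then for all antichains A, B of P, the absorption law A ∧ (A ∨ B) = A holds, where A ∨ B = (A ∪ B)↑ and A ∧ B = (A↓ ∩ B↓)↑. -/
/-- If `>` is well-founded on the partially ordered set `P`, then for all
antichains `A, B ⊆ P`, the absorption law `A ∧ (A ∨ B) = A` holds. -/
theorem stmt_6 {P : Type*} [PartialOrder P]
    (hwf : WellFounded ((· > ·) : P → P → Prop)) (A B : Set P)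
    (hA : IsAntichain (· ≤ ·) A) (hB : IsAntichain (· ≤ ·) B) :
    meetA A (joinA A B) = A := by
  have key : ∀ a ∈ A, a ∈ downSet (joinA A B) := by
    intro a ha
    obtain ⟨m, ⟨hm, ham⟩, hmin⟩ :=
      hwf.has_min {x | x ∈ A ∪ B ∧ a ≤ x} ⟨a, Or.inl ha, le_refl a⟩
    exact ⟨m, ⟨hm, fun b hb hlt => hmin b ⟨hb, ham.trans hlt.le⟩ hlt⟩, ham⟩
  ext x
  constructor
  · rintro ⟨⟨⟨a, ha, hxa⟩, _⟩, hmax⟩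
    rcases hxa.eq_or_lt with h | h
    · exact h ▸ ha
    · exact (hmax a ⟨⟨a, ha, le_refl a⟩, key a ha⟩ h).elim
  · intro hx
    refine ⟨⟨⟨x, hx, le_refl x⟩, key x hx⟩, ?_⟩
    rintro b ⟨⟨a, ha, hba⟩, _⟩ hlt
    have hlt' : x < a := hlt.trans_le hba
    exact hA hx ha hlt'.ne hlt'.le
end

section
/- Let P be a partially ordered set in which the relation > is well-founded. Then for all antichains A, B, C of P, the distributive law A ∧ (B ∨ C) = (A ∧ B) ∨ (A ∧ C) holds, where A ∨ B = (A ∪ B)↑ and A ∧ B = (A↓ ∩ B↓)↑. -/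
theorem upSet_downSet_aux {P : Type*} [PartialOrder P] (X : Set P) :
    upSet (downSet X) = upSet X := by
  ext p
  constructor
  · rintro ⟨⟨a, ha, hpa⟩, hmax⟩
    have hp : p = a := by
      by_contra hne
      exact hmax a ⟨a, ha, le_rfl⟩ (lt_of_le_of_ne hpa hne)
    subst hp
    exact ⟨ha, fun b hb => hmax b ⟨b, hb, le_rfl⟩⟩
  · rintro ⟨hp, hmax⟩
    refine ⟨⟨p, hp, le_rfl⟩, ?_⟩
    rintro b ⟨c, hc, hbc⟩ hlt
    exact hmax c hc (lt_of_lt_of_le hlt hbc)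

theorem downSet_upSet_aux {P : Type*} [PartialOrder P]
    (hwf : WellFounded ((· > ·) : P → P → Prop)) (X : Set P) :
    downSet (upSet X) = downSet X := by
  ext p
  constructor
  · rintro ⟨a, ha, hpa⟩
    exact ⟨a, ha.1, hpa⟩
  · rintro ⟨a, ha, hpa⟩
    obtain ⟨m, ⟨hm, ham⟩, hmin⟩ := hwf.has_min {x | x ∈ X ∧ a ≤ x} ⟨a, ha, le_rfl⟩
    exact ⟨m, ⟨hm, fun b hb hlt => hmin b ⟨hb, ham.trans hlt.le⟩ hlt⟩, hpa.trans ham⟩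

theorem downSet_union_aux {P : Type*} [PartialOrder P] (X Y : Set P) :
    downSet (X ∪ Y) = downSet X ∪ downSet Y := by
  ext p
  simp only [downSet, Set.mem_union, Set.mem_setOf_eq, or_and_right, exists_or]

/-- If `>` is well-founded on the partially ordered set `P`, then for all
antichains `A, B, C ⊆ P`, the distributive law
`A ∧ (B ∨ C) = (A ∧ B) ∨ (A ∧ C)` holds. -/
theorem stmt_7 {P : Type*} [PartialOrder P]
    (hwf : WellFounded ((· > ·) : P → P → Prop)) (A B C : Set P)
    (hA : IsAntichain (· ≤ ·) A) (hB : IsAntichain (· ≤ ·) B)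
    (hC : IsAntichain (· ≤ ·) C) :
    meetA A (joinA B C) = joinA (meetA A B) (meetA A C) := by
  unfold meetA joinA
  rw [downSet_upSet_aux hwf, downSet_union_aux, Set.inter_union_distrib_left,
    ← upSet_downSet_aux (upSet _ ∪ upSet _), downSet_union_aux, downSet_upSet_aux hwf,
    downSet_upSet_aux hwf, ← downSet_union_aux, upSet_downSet_aux]
end

section
/- Let P be a partially ordered set, let M be a lattice with a least element ⊥, and let f : P → M be order-preserving. Define F on finite antichains of P by F(A) = the finite supremum of f over A (with F(∅) = ⊥). Then F({p}) = f(p) for every p ∈ P, and F preserves joins: for all finite antichains A, B of P, F((A ∪ B)↑) = F(A) ⊔ F(B). -/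
open scoped Classical

/-- `upF A` is the finset of maximal elements of the finset `A`: those `a ∈ A`
such that no `a' ∈ A` satisfies `a < a'`. -/
noncomputable def upF {P : Type*} [PartialOrder P] (A : Finset P) : Finset P :=
  A.filter (fun a => ∀ b ∈ A, ¬ a < b)

/-- Let `P` be a poset, `M` a lattice with least element `⊥` and `f : P → M`
order-preserving.  Defining `F` on finite antichains by `F A = sup of f over A`
(so `F ∅ = ⊥`), we have `F {p} = f p` for every `p`, and `F` preserves joins:
`F ((A ∪ B)↑) = F A ⊔ F B` for all finite antichains `A`, `B`. -/
theorem stmt_9 {P : Type*} [PartialOrder P] {M : Type*} [Lattice M] [OrderBot M]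
    (f : P → M) (hf : Monotone f) :
    (∀ p : P, ({p} : Finset P).sup f = f p) ∧
    (∀ A B : Finset P, IsAntichain (· ≤ ·) (A : Set P) →
      IsAntichain (· ≤ ·) (B : Set P) →
      (upF (A ∪ B)).sup f = A.sup f ⊔ B.sup f) := by
  refine ⟨fun p => Finset.sup_singleton, fun A B _ _ => ?_⟩
  rw [← Finset.sup_union]
  apply le_antisymm
  · exact Finset.sup_mono (Finset.filter_subset _ _)
  · refine Finset.sup_le fun a ha => ?_
    obtain ⟨m, ham, hm⟩ := (A ∪ B).exists_le_maximal ha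
    refine (hf ham).trans (Finset.le_sup (f := f) ?_)
    exact Finset.mem_filter.2 ⟨hm.prop, fun b hb hlt => hm.not_prop_of_gt hlt hb⟩
end

section
/- Fixed points reached by extensions are unique: let S be a meet-semilattice, let f, g : S → S be order-preserving, and set F(s) = s ⊓ f(s) and G(s) = s ⊓ g(s). For any d ∈ S, if G(F(d)) = F(d) and F(G(d)) = G(d), then F(d) = G(d). -/
/-- The extension of a meet-semilattice determined by an order-preserving
`f : S → S` is the map `s ↦ s ⊓ f s`. -/
def extMap {S : Type*} [SemilatticeInf S] (f : S → S) (s : S) : S :=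
  s ⊓ f s

/-- Fixed points reached by extensions are unique: for extensions
`F s = s ⊓ f s` and `G s = s ⊓ g s` of a meet-semilattice (`f`, `g`
order-preserving) and any `d`, if `G (F d) = F d` and `F (G d) = G d`, then
`F d = G d`. -/
theorem stmt_14 {S : Type*} [SemilatticeInf S] (f g : S → S)
    (hf : Monotone f) (hg : Monotone g) (d : S)
    (h1 : extMap g (extMap f d) = extMap f d)
    (h2 : extMap f (extMap g d) = extMap g d) :
    extMap f d = extMap g d := by
  have mono : ∀ k : S → S, Monotone k → ∀ a b : S, a ≤ b → extMap k a ≤ extMap k b :=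
    fun k hk a b hab => inf_le_inf hab (hk hab)
  apply le_antisymm
  · rw [← h1]
    exact mono g hg _ _ inf_le_left
  · rw [← h2]
    exact mono f hf _ _ inf_le_left
end

section
/- Let S be a meet-semilattice, let f : S → S be order-preserving, and set F(s) = s ⊓ f(s). Let a, a', b, b' ∈ S satisfy F(a) = F(a') and F(b) = F(b'), and suppose F(a ⊓ b) and F(a' ⊓ b') are fixed points of F. Then F(a ⊓ b) = F(a' ⊓ b'); that is, the meet operation descends to equivalence classes of elements having the same fixed point. -/
/-- For an extension `F s = s ⊓ f s` of a meet-semilattice (`f`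
order-preserving): if `F a = F a'`, `F b = F b'`, and both `F (a ⊓ b)` and
`F (a' ⊓ b')` are fixed points of `F`, then `F (a ⊓ b) = F (a' ⊓ b')`; the meet
descends to equivalence classes of elements with the same fixed point. -/
theorem stmt_16 {S : Type*} [SemilatticeInf S] (f : S → S) (hf : Monotone f)
    (a a' b b' : S) (ha : extMap f a = extMap f a') (hb : extMap f b = extMap f b')
    (hfix : extMap f (extMap f (a ⊓ b)) = extMap f (a ⊓ b))
    (hfix' : extMap f (extMap f (a' ⊓ b')) = extMap f (a' ⊓ b')) :
    extMap f (a ⊓ b) = extMap f (a' ⊓ b') := by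
  have mono : ∀ x y : S, x ≤ y → extMap f x ≤ extMap f y :=
    fun x y h => inf_le_inf h (hf h)
  have le : ∀ x : S, extMap f x ≤ x := fun x => inf_le_left
  apply le_antisymm
  · rw [← hfix]
    exact mono _ _ (le_inf
      (((mono _ _ inf_le_left).trans ha.le).trans (le a'))
      (((mono _ _ inf_le_right).trans hb.le).trans (le b')))
  · rw [← hfix']
    exact mono _ _ (le_inf
      (((mono _ _ inf_le_left).trans ha.ge).trans (le a))
      (((mono _ _ inf_le_right).trans hb.ge).trans (le b)))
end
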